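/- (Zhevlakov) Let N be a nonassociative (possibly noncommutative) algebra over a field K. Assume that N satisfies the ascending chain condition on two-sided ideals, and that N is locally nilpotent (every finitely generated subalgebra is nilpotent). Then N is finite-dimensional over K. -/

import Mathlib

/-- The product of two subspaces of a (possibly non-associative, non-unital, non-commutative)
algebra: the linear span of all products `x * y` with `x ∈ M`, `y ∈ N`. -/
def subMul {K A : Type*} [Field K] [NonUnitalNonAssocRing A] [Module K A]
    [SMulCommClass K A A] [IsScalarTower K A A]
    (M N : Submodule K A) : Submodule K A :=
  Submodule.map₂ (LinearMap.mul K A) M N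

/-- The powers `Sⁱ` of a subspace `S`, defined (for `i ≥ 1`) by `S¹ = S` and
`Sⁱ = Σ_{r+s=i, r,s ≥ 1} Sʳ Sˢ`.  (We set `S⁰ = S`, an irrelevant junk value.) -/
def algPow {K A : Type*} [Field K] [NonUnitalNonAssocRing A] [Module K A]
    [SMulCommClass K A A] [IsScalarTower K A A]
    (S : Submodule K A) : ℕ → Submodule K A
  | 0 => S
  | 1 => S
  | n + 2 => ⨆ r : Fin (n + 1), subMul (algPow S (r + 1)) (algPow S (n + 1 - r))
  decreasing_by
  · omega
  · omega

section

variable {K A : Type*} [Field K] [NonUnitalNonAssocRing A] [Module K A]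

/-- A subspace of `A` which is closed under left and right multiplication by elements of `A`. -/
def IsTwoSidedIdeal (J : Submodule K A) : Prop :=
  ∀ a : A, ∀ x ∈ J, a * x ∈ J ∧ x * a ∈ J

/-- The two-sided ideal generated by a set. -/
def twoSidedIdealSpan (K : Type*) {A : Type*} [Field K] [NonUnitalNonAssocRing A] [Module K A]
    (X : Set A) : Submodule K A :=
  sInf {J | IsTwoSidedIdeal J ∧ X ⊆ J}

theorem twoSidedIdealSpan_isTwoSidedIdeal (X : Set A) :
    IsTwoSidedIdeal (twoSidedIdealSpan K X) := by
  intro a x hx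
  simp only [twoSidedIdealSpan, Submodule.mem_sInf] at hx ⊢
  exact ⟨fun J hJ => (hJ.1 a x (hx J hJ)).1, fun J hJ => (hJ.1 a x (hx J hJ)).2⟩

theorem subset_twoSidedIdealSpan (X : Set A) : X ⊆ twoSidedIdealSpan K X := fun x hx => by
  simp only [twoSidedIdealSpan, SetLike.mem_coe, Submodule.mem_sInf]
  exact fun J hJ => hJ.2 hx

theorem twoSidedIdealSpan_le {X : Set A} {J : Submodule K A} (hJ : IsTwoSidedIdeal J)
    (hX : X ⊆ J) : twoSidedIdealSpan K X ≤ J :=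
  sInf_le ⟨hJ, hX⟩

theorem twoSidedIdealSpan_mono {X Y : Set A} (h : X ⊆ Y) :
    twoSidedIdealSpan K X ≤ twoSidedIdealSpan K Y :=
  twoSidedIdealSpan_le (twoSidedIdealSpan_isTwoSidedIdeal Y)
    (h.trans (subset_twoSidedIdealSpan Y))

theorem exists_finset_le_of_acc
    (hacc : ∀ f : ℕ → Submodule K A, (∀ k, IsTwoSidedIdeal (f k)) → Monotone f →
      ∃ n, ∀ m, n ≤ m → f m = f n)
    {g : Finset A → Submodule K A} (hg : ∀ X, IsTwoSidedIdeal (g X)) (hmono : Monotone g)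
    (hsub : ∀ X : Finset A, (X : Set A) ⊆ g X) (W : Submodule K A) :
    ∃ X : Finset A, (X : Set A) ⊆ W ∧ W ≤ g X := by
  classical
  have : WellFoundedGT {J : Submodule K A // IsTwoSidedIdeal J} := by
    rw [wellFoundedGT_iff_monotone_chain_condition]
    intro f
    obtain ⟨n, hn⟩ := hacc (fun k => f k) (fun k => (f k).2) fun _ _ h => f.monotone h
    exact ⟨n, fun m hm => Subtype.ext (hn m hm).symm⟩
  obtain ⟨_, ⟨X, hXW, rfl⟩, hmax⟩ := this.wf.has_min
    {J | ∃ X : Finset A, (X : Set A) ⊆ W ∧ ⟨g X, hg X⟩ = J} ⟨_, ∅, by simp, rfl⟩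
  refine ⟨X, hXW, fun y hy => ?_⟩
  have hle : g X ≤ g (insert y X) := hmono (Finset.subset_insert y X)
  have hnlt := hmax ⟨g (insert y X), hg _⟩ ⟨insert y X, by
    simp [Set.insert_subset_iff, hXW, SetLike.mem_coe.2 hy], rfl⟩
  by_contra hyX
  refine hnlt (lt_of_le_of_ne hle fun h => hyX ?_)
  rw [show g X = g (insert y X) from congrArg Subtype.val h]
  exact hsub (insert y X) (by simp)

end

section

variable {K A : Type*} [Field K] [NonUnitalNonAssocRing A] [Module K A]
  [SMulCommClass K A A] [IsScalarTower K A A]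

theorem subMul_le {M P Q : Submodule K A} :
    subMul M P ≤ Q ↔ ∀ m ∈ M, ∀ p ∈ P, m * p ∈ Q :=
  Submodule.map₂_le

theorem mul_mem_subMul {M P : Submodule K A} {x y : A} (hx : x ∈ M) (hy : y ∈ P) :
    x * y ∈ subMul M P :=
  Submodule.apply_mem_map₂ (LinearMap.mul K A) hx hy

theorem subMul_toSubmodule_le (B : NonUnitalSubalgebra K A) :
    subMul B.toSubmodule B.toSubmodule ≤ B.toSubmodule :=
  subMul_le.2 fun _ ha _ hb => B.mul_mem' ha hb

theorem algPow_one (S : Submodule K A) : algPow S 1 = S := by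
  rw [algPow]

theorem algPow_le_iff {S Q : Submodule K A} {n : ℕ} (hn : 2 ≤ n) :
    algPow S n ≤ Q ↔
      ∀ r s, 1 ≤ r → 1 ≤ s → r + s = n → ∀ x ∈ algPow S r, ∀ y ∈ algPow S s, x * y ∈ Q := by
  obtain ⟨n, rfl⟩ := Nat.exists_eq_add_of_le' hn
  rw [algPow, iSup_le_iff]
  simp only [subMul_le]
  constructor
  · intro h r s hr hs hrs
    obtain ⟨r, rfl⟩ := Nat.exists_eq_add_of_le' hr
    obtain rfl : s = n + 1 - r := by omega
    exact h ⟨r, by omega⟩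
  · rintro h ⟨r, hr⟩
    exact h _ _ (by simp) (by simp; omega) (by simp; omega)

theorem mul_mem_algPow {S : Submodule K A} {r s : ℕ} (hr : 1 ≤ r) (hs : 1 ≤ s) {x y : A}
    (hx : x ∈ algPow S r) (hy : y ∈ algPow S s) : x * y ∈ algPow S (r + s) :=
  (algPow_le_iff (by omega)).1 le_rfl r s hr hs rfl x hx y hy

theorem algPow_mono {S T : Submodule K A} (h : S ≤ T) {n : ℕ} (hn : 1 ≤ n) :
    algPow S n ≤ algPow T n := by
  induction n using Nat.strong_induction_on with
  | _ n ih =>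
    obtain rfl | hn2 : n = 1 ∨ 2 ≤ n := by omega
    · simpa only [algPow_one]
    · refine (algPow_le_iff hn2).2 fun r s hr hs hrs x hx y hy => ?_
      subst hrs
      exact mul_mem_algPow hr hs (ih r (by omega) hr hx) (ih s (by omega) hs hy)

theorem algPow_succ_le {S : Submodule K A} (hS : subMul S S ≤ S) {n : ℕ} (hn : 1 ≤ n) :
    algPow S (n + 1) ≤ algPow S n := by
  induction n using Nat.strong_induction_on with
  | _ n ih =>
    refine (algPow_le_iff (by omega)).2 fun r s hr hs hrs x hx y hy => ?_
    obtain rfl | hn2 : n = 1 ∨ 2 ≤ n := by omega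
    · obtain rfl : r = 1 := by omega
      obtain rfl : s = 1 := by omega
      rw [algPow_one] at *
      exact hS (mul_mem_subMul hx hy)
    · obtain hr2 | hs2 : 2 ≤ r ∨ 2 ≤ s := by omega
      · obtain ⟨r, rfl⟩ := Nat.exists_eq_add_of_le' hr
        obtain rfl : n = r + s := by omega
        exact mul_mem_algPow (by omega) hs (ih r (by omega) (by omega) hx) hy
      · obtain ⟨s, rfl⟩ := Nat.exists_eq_add_of_le' hs
        obtain rfl : n = r + s := by omega
        exact mul_mem_algPow hr (by omega) hx (ih s (by omega) (by omega) hy)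

theorem algPow_anti {S : Submodule K A} (hS : subMul S S ≤ S) {m n : ℕ} (hm : 1 ≤ m)
    (hmn : m ≤ n) : algPow S n ≤ algPow S m := by
  induction n, hmn using Nat.le_induction with
  | base => exact le_rfl
  | succ k hk ih => exact (algPow_succ_le hS (hm.trans hk)).trans ih

theorem algPow_finiteDimensional (V : Submodule K A) [FiniteDimensional K V] (n : ℕ) :
    FiniteDimensional K (algPow V n) := by
  induction n using Nat.strong_induction_on with
  | _ n ih =>
    match n with
    | 0 => rw [algPow]; infer_instance
    | 1 => rw [algPow]; infer_instance
    | n + 2 =>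
      rw [algPow]
      have (r : Fin (n + 1)) : FiniteDimensional K
          (subMul (algPow V (r + 1)) (algPow V (n + 1 - r))) := by
        rw [← Submodule.fg_iff_finiteDimensional]
        exact Submodule.FG.map₂ _
          ((Submodule.fg_iff_finiteDimensional _).2 (ih _ (by omega)))
          ((Submodule.fg_iff_finiteDimensional _).2 (ih _ (by omega)))
      exact Submodule.finiteDimensional_iSup _

theorem subMul_top_le : subMul (⊤ : Submodule K A) ⊤ ≤ ⊤ := le_top

theorem algPow_top_le_sup {V : Submodule K A} (hV : V ⊔ algPow ⊤ 2 = ⊤) {n : ℕ} (hn : 1 ≤ n) :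
    algPow ⊤ n ≤ algPow V n ⊔ algPow ⊤ (n + 1) := by
  induction n using Nat.strong_induction_on with
  | _ n ih =>
    obtain rfl | hn2 : n = 1 ∨ 2 ≤ n := by omega
    · simp only [algPow_one, hV, Nat.reduceAdd, le_refl]
    · refine (algPow_le_iff hn2).2 fun r s hr hs hrs x hx y hy => ?_
      subst hrs
      obtain ⟨v, hv, x', hx', rfl⟩ := Submodule.mem_sup.1 (ih r (by omega) hr hx)
      obtain ⟨w, hw, y', hy', rfl⟩ := Submodule.mem_sup.1 (ih s (by omega) hs hy)
      rw [add_mul, mul_add v, add_assoc (v * w)]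
      refine Submodule.add_mem_sup (mul_mem_algPow hr hs hv hw) (add_mem ?_ ?_)
      · exact mul_mem_algPow hr (by omega) (algPow_mono le_top hr hv) hy'
      · rw [add_right_comm]
        exact mul_mem_algPow (by omega) hs hx' hy

/-- The elements that lie in `T ^ (k + c)` for every sufficiently large subalgebra `T` and every
`k ≥ 1` such that `X ⊆ T ^ k`. -/
def eventualPow (K : Type*) {A : Type*} [Field K] [NonUnitalNonAssocRing A] [Module K A]
    [SMulCommClass K A A] [IsScalarTower K A A] (X : Finset A) (c : ℕ) : Submodule K A where
  carrier := {y | ∃ F : Finset A, ∀ T : Submodule K A, subMul T T ≤ T → (F : Set A) ⊆ T →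
    ∀ k, 1 ≤ k → (X : Set A) ⊆ algPow T k → y ∈ algPow T (k + c)}
  zero_mem' := ⟨∅, fun _ _ _ _ _ _ => zero_mem _⟩
  add_mem' := by
    classical
    rintro x y ⟨F, hF⟩ ⟨G, hG⟩
    refine ⟨F ∪ G, fun T hT hFG k hk hX => ?_⟩
    rw [Finset.coe_union, Set.union_subset_iff] at hFG
    exact add_mem (hF T hT hFG.1 k hk hX) (hG T hT hFG.2 k hk hX)
  smul_mem' := by
    rintro a x ⟨F, hF⟩
    exact ⟨F, fun T hT hFT k hk hX => Submodule.smul_mem _ _ (hF T hT hFT k hk hX)⟩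

theorem mul_mem_eventualPow {X : Finset A} {c : ℕ} {x : A} (hx : x ∈ eventualPow K X c) (a : A) :
    a * x ∈ eventualPow K X (c + 1) ∧ x * a ∈ eventualPow K X (c + 1) := by
  classical
  obtain ⟨F, hF⟩ := hx
  constructor <;> refine ⟨insert a F, fun T hT hFT k hk hX => ?_⟩ <;>
    rw [Finset.coe_insert, Set.insert_subset_iff] at hFT <;>
    have hx := hF T hT hFT.2 k hk hX <;>
    have ha : a ∈ algPow T 1 := by rw [algPow_one]; exact hFT.1
  · rw [← add_assoc, add_comm (k + c)]
    exact mul_mem_algPow le_rfl (by omega) ha hx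
  · exact mul_mem_algPow (r := k + c) (by omega) le_rfl hx ha

theorem eventualPow_succ_le (X : Finset A) (c : ℕ) :
    eventualPow K X (c + 1) ≤ eventualPow K X c := by
  rintro x ⟨F, hF⟩
  exact ⟨F, fun T hT hFT k hk hX => algPow_succ_le hT (by omega) (hF T hT hFT k hk hX)⟩

theorem eventualPow_isTwoSidedIdeal (X : Finset A) (c : ℕ) :
    IsTwoSidedIdeal (eventualPow K X c) := fun a _ hx =>
  ⟨eventualPow_succ_le X c (mul_mem_eventualPow hx a).1,
    eventualPow_succ_le X c (mul_mem_eventualPow hx a).2⟩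

theorem subset_eventualPow_zero (X : Finset A) : (X : Set A) ⊆ eventualPow K X 0 :=
  fun _ hx => ⟨∅, fun _ _ _ _ _ hX => hX hx⟩

theorem exists_algPow_adjoin_of_subset_eventualPow {X : Finset A}
    (hX : (X : Set A) ⊆ eventualPow K X 1) :
    ∃ F : Finset A, ∀ k, 1 ≤ k →
      (X : Set A) ⊆ algPow (NonUnitalAlgebra.adjoin K (F : Set A)).toSubmodule k := by
  classical
  choose! G hG using hX
  let F := X ∪ X.biUnion G
  have hF : (F : Set A) ⊆ NonUnitalAlgebra.adjoin K (F : Set A) := NonUnitalAlgebra.subset_adjoin K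
  refine ⟨F, fun k hk => ?_⟩
  induction k, hk using Nat.le_induction with
  | base =>
    rw [algPow_one]
    exact fun x hx => hF (by simp [F, Finset.mem_coe.1 hx])
  | succ k hk ih =>
    refine fun x hx => hG hx _ (subMul_toSubmodule_le _)
      (fun y hy => hF ?_) k hk ih
    simp only [F, Finset.coe_union, Finset.coe_biUnion]
    exact Or.inr (Set.mem_biUnion hx hy)

theorem eq_bot_of_le_subMul_sup
    (hacc : ∀ f : ℕ → Submodule K A, (∀ k, IsTwoSidedIdeal (f k)) → Monotone f →
      ∃ n, ∀ m, n ≤ m → f m = f n)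
    (hln : ∀ s : Finset A,
      ∃ n, 1 ≤ n ∧ algPow (NonUnitalAlgebra.adjoin K (s : Set A)).toSubmodule n = ⊥)
    {I : Submodule K A} (h : I ≤ subMul I ⊤ ⊔ subMul ⊤ I) :
    I = ⊥ := by
  obtain ⟨X, hXI, hIX⟩ := exists_finset_le_of_acc hacc
    (g := fun X : Finset A => twoSidedIdealSpan K (X : Set A))
    (fun X => twoSidedIdealSpan_isTwoSidedIdeal _)
    (fun X Y hXY => twoSidedIdealSpan_mono (by exact_mod_cast hXY))
    (fun X => subset_twoSidedIdealSpan _) I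
  have hI0 : I ≤ eventualPow K X 0 := hIX.trans
    (twoSidedIdealSpan_le (eventualPow_isTwoSidedIdeal X 0) (subset_eventualPow_zero X))
  have hI1 : I ≤ eventualPow K X 1 := h.trans <| sup_le
    (subMul_le.2 fun x hx a _ => (mul_mem_eventualPow (hI0 hx) a).2)
    (subMul_le.2 fun a _ x hx => (mul_mem_eventualPow (hI0 hx) a).1)
  obtain ⟨F, hF⟩ := exists_algPow_adjoin_of_subset_eventualPow (hXI.trans hI1)
  obtain ⟨n, hn, hbot⟩ := hln F
  refine le_bot_iff.1 (hIX.trans (twoSidedIdealSpan_le (fun a x hx => ?_) (hbot ▸ hF n hn)))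
  simp [(Submodule.mem_bot K).1 hx]

theorem algPow_top_le_subMul_sup {V : Submodule K A} (hV : V ⊔ algPow ⊤ 2 = ⊤) {n : ℕ}
    (hn : 1 ≤ n) (hVn : ∀ m, n ≤ m → algPow V m = ⊥) :
    algPow (⊤ : Submodule K A) n ≤ subMul (algPow ⊤ n) ⊤ ⊔ subMul ⊤ (algPow ⊤ n) := by
  have hstable (m : ℕ) (hm : n ≤ m) : algPow (⊤ : Submodule K A) n ≤ algPow ⊤ m := by
    induction m, hm using Nat.le_induction with
    | base => exact le_rfl
    | succ m hm ih =>
      refine ih.trans ?_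
      simpa [hVn m hm] using algPow_top_le_sup hV (hn.trans hm)
  refine (hstable (2 * n) (by omega)).trans ((algPow_le_iff (by omega)).2 ?_)
  intro r s hr hs hrs x hx y hy
  obtain h | h : n ≤ r ∨ n ≤ s := by omega
  · exact Submodule.mem_sup_left (mul_mem_subMul (algPow_anti subMul_top_le hn h hx) trivial)
  · exact Submodule.mem_sup_right (mul_mem_subMul trivial (algPow_anti subMul_top_le hn h hy))

theorem finiteDimensional_of_algPow_top_eq_bot {V : Submodule K A} [FiniteDimensional K V]
    (hV : V ⊔ algPow ⊤ 2 = ⊤) {n : ℕ} (hn : 1 ≤ n) (h : algPow (⊤ : Submodule K A) n = ⊥) :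
    FiniteDimensional K A := by
  have key (m : ℕ) (hm : 1 ≤ m) :
      ∃ W : Submodule K A, FiniteDimensional K W ∧ W ⊔ algPow ⊤ m = ⊤ := by
    induction m, hm using Nat.le_induction with
    | base => exact ⟨⊥, inferInstance, by simp [algPow_one]⟩
    | succ m hm ih =>
      obtain ⟨W, hW, hWm⟩ := ih
      have := algPow_finiteDimensional V m
      refine ⟨W ⊔ algPow V m, inferInstance, top_le_iff.1 ?_⟩
      rw [sup_assoc]
      exact hWm.ge.trans <| sup_le_sup_left (algPow_top_le_sup hV hm) W
  obtain ⟨W, hW, hWn⟩ := key n hn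
  rw [h, sup_bot_eq] at hWn
  subst hWn
  exact Module.finite_def.2 ((Submodule.fg_iff_finiteDimensional _).2 hW)

end

/-- **Zhevlakov.**  Let `N` be a nonassociative (possibly noncommutative) algebra
over a field `K` satisfying the ascending chain condition on two-sided ideals.  If `N` is
locally nilpotent (every finitely generated subalgebra is nilpotent), then `N` is
finite-dimensional over `K`. -/
theorem zhevlakov_locallyNilpotent_noetherian_finiteDimensional {K N : Type*} [Field K]
    [NonUnitalNonAssocRing N] [Module K N] [SMulCommClass K N N] [IsScalarTower K N N]
    -- a.c.c. on two-sided ideals of `N`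
    (hacc : ∀ f : ℕ → Submodule K N,
      (∀ k, ∀ a : N, ∀ x ∈ f k, a * x ∈ f k ∧ x * a ∈ f k) → Monotone f →
      ∃ n, ∀ m, n ≤ m → f m = f n)
    -- `N` is locally nilpotent
    (hln : ∀ s : Finset N,
      ∃ n, 1 ≤ n ∧ algPow (NonUnitalAlgebra.adjoin K (↑s : Set N)).toSubmodule n = ⊥) :
    FiniteDimensional K N := by
  obtain ⟨X, -, hX⟩ := exists_finset_le_of_acc hacc
    (g := fun X : Finset N => Submodule.span K (X : Set N) ⊔ algPow ⊤ 2)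
    (fun X a x _ => by
      have h (b c : N) : b * c ∈ algPow (⊤ : Submodule K N) 2 :=
        mul_mem_algPow (r := 1) (s := 1) le_rfl le_rfl
          (by simp [algPow_one]) (by simp [algPow_one])
      exact ⟨Submodule.mem_sup_right (h a x), Submodule.mem_sup_right (h x a)⟩)
    (fun X Y hXY => sup_le_sup_right (Submodule.span_mono (by exact_mod_cast hXY)) _)
    (fun X => Submodule.subset_span.trans (SetLike.coe_subset_coe.2 le_sup_left)) ⊤
  rw [top_le_iff] at hX
  obtain ⟨n, hn, hbot⟩ := hln X
  have hVn (m : ℕ) (hm : n ≤ m) : algPow (Submodule.span K (X : Set N)) m = ⊥ := by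
    refine le_bot_iff.1 ((algPow_mono ?_ (hn.trans hm)).trans
      ((algPow_anti (subMul_toSubmodule_le _) hn hm).trans hbot.le))
    exact Submodule.span_le.2 (NonUnitalAlgebra.subset_adjoin K)
  exact finiteDimensional_of_algPow_top_eq_bot hX hn
    (eq_bot_of_le_subMul_sup hacc hln (algPow_top_le_subMul_sup hX hn hVn))
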